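/- arXiv:2202.00404 — 3 statements merged into one kernel-verified Lean document; each statement's English description precedes it below -/
import Mathlib

section
/- Let b∈(0,1). There exists a constant C > 0, depending only on b, such that for every λ>0 and every integer n ≥ 1, | I_n(λb)·K_n(λ) − bⁿ/(2n) | ≤ C·max(|log λ|, 1)·λ². -/
open Real MeasureTheory Filter

/-- Modified Bessel function of the first kind `I_n`. -/
noncomputable def besselI (n : ℕ) (x : ℝ) : ℝ :=
  ∑' m : ℕ, (x / 2) ^ (n + 2 * m) / ((Nat.factorial m : ℝ) * (Nat.factorial (n + m) : ℝ))

/-- Modified Bessel function of the second kind `K_n`. -/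
noncomputable def besselK (n : ℕ) (x : ℝ) : ℝ :=
  ∫ t in Set.Ioi (0 : ℝ), Real.exp (-x * Real.cosh t) * Real.cosh ((n : ℝ) * t)

/-- `Λ_n(λ,b) = I_n(λb) K_n(λ)`. -/
noncomputable def Lam (n : ℕ) (l b : ℝ) : ℝ := besselI n (l * b) * besselK n l

/-- `Ω_n(x) = I_1(x)K_1(x) − I_n(x)K_n(x)`. -/
noncomputable def Om (n : ℕ) (x : ℝ) : ℝ :=
  besselI 1 x * besselK 1 x - besselI n x * besselK n x

/-- Discriminant `Δ_n(λ,b)`. -/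
noncomputable def Del (n : ℕ) (l b : ℝ) : ℝ :=
  (b * (Om n l + Om n (l * b)) - (1 + b ^ 2) * Lam 1 l b) ^ 2 - 4 * b ^ 2 * Lam n l b ^ 2

/-- `B_n(λ,b)`. -/
noncomputable def Bfun (n : ℕ) (l b : ℝ) : ℝ :=
  (1 - b ^ 2) * Lam 1 l b + b * (Om n l - Om n (l * b))

/-- `Ω_n^+(λ,b)`. -/
noncomputable def OmP (n : ℕ) (l b : ℝ) : ℝ :=
  (Bfun n l b + Real.sqrt (Del n l b)) / (2 * b)

/-- `Ω_n^−(λ,b)`. -/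
noncomputable def OmM (n : ℕ) (l b : ℝ) : ℝ :=
  (Bfun n l b - Real.sqrt (Del n l b)) / (2 * b)

/-- The matrix `M_n(λ,b,Ω)`. -/
noncomputable def Mmat (n : ℕ) (l b W : ℝ) : Matrix (Fin 2) (Fin 2) ℝ :=
  !![Om n l - W - b * Lam 1 l b, b * Lam n l b;
     -Lam n l b, Lam 1 l b - b * (Om n (l * b) + W)]

/-- Each term of the series of `besselI`, weighted by `exp (n t)`, is dominated by a term of an
exponential series. -/
lemma besselI_term_mul_exp_le (n m : ℕ) {y : ℝ} (hy : 0 ≤ y) (t : ℝ) :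
    (y / 2) ^ (n + 2 * m) / ((Nat.factorial m : ℝ) * (Nat.factorial (n + m) : ℝ)) * exp (n * t)
      ≤ exp (y / 2 * exp t) * ((y / 2 * exp (-t)) ^ m / (Nat.factorial m : ℝ)) := by
  have key : (y / 2) ^ (n + 2 * m) * exp (n * t)
      = (y / 2 * exp t) ^ (n + m) * (y / 2 * exp (-t)) ^ m := by
    have h1 : exp t * exp (-t) = 1 := by rw [← exp_add]; simp
    calc (y / 2) ^ (n + 2 * m) * exp (n * t)
        = (y / 2) ^ (n + 2 * m) * exp t ^ n * (exp t * exp (-t)) ^ m := by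
          rw [h1, exp_nat_mul]; simp
      _ = _ := by
          rw [pow_add, pow_add, pow_mul']
          ring
  have h := pow_div_factorial_le_exp (y / 2 * exp t) (by positivity) (n + m)
  calc _ = (y / 2 * exp t) ^ (n + m) / (Nat.factorial (n + m) : ℝ)
        * ((y / 2 * exp (-t)) ^ m / (Nat.factorial m : ℝ)) := by
        rw [div_mul_eq_mul_div, key]; field_simp
    _ ≤ _ := by gcongr

lemma hasSum_exp_mul_pow_div_factorial (c x : ℝ) :
    HasSum (fun m : ℕ => exp c * (x ^ m / (Nat.factorial m : ℝ))) (exp (c + x)) := by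
  rw [exp_add]
  refine HasSum.mul_left _ ?_
  rw [Real.exp_eq_exp_ℝ]
  exact NormedSpace.expSeries_div_hasSum_exp x

lemma summable_besselI (n : ℕ) {y : ℝ} (hy : 0 ≤ y) :
    Summable fun m : ℕ =>
      (y / 2) ^ (n + 2 * m) / ((Nat.factorial m : ℝ) * (Nat.factorial (n + m) : ℝ)) :=
  Summable.of_nonneg_of_le (fun m => by positivity)
    (fun m => by simpa using besselI_term_mul_exp_le n m hy 0)
    (hasSum_exp_mul_pow_div_factorial _ _).summable

lemma besselI_mul_exp_le (n : ℕ) {y : ℝ} (hy : 0 ≤ y) (t : ℝ) :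
    besselI n y * exp (n * t) ≤ exp (y * cosh t) := by
  have h := hasSum_le (fun m => besselI_term_mul_exp_le n m hy t)
    ((summable_besselI n hy).hasSum.mul_right (exp (n * t)))
    (hasSum_exp_mul_pow_div_factorial _ _)
  refine h.trans_eq ?_
  rw [cosh_eq]; ring_nf

lemma besselI_nonneg (n : ℕ) {y : ℝ} (hy : 0 ≤ y) : 0 ≤ besselI n y :=
  tsum_nonneg fun m => by positivity

lemma le_besselI (n : ℕ) {y : ℝ} (hy : 0 ≤ y) :
    (y / 2) ^ n / (Nat.factorial n : ℝ) ≤ besselI n y := by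
  simpa [besselI] using (summable_besselI n hy).le_tsum 0 fun m _ => by positivity

lemma besselI_le (n : ℕ) {y : ℝ} (hy : 0 ≤ y) (hy2 : y < 2) :
    besselI n y ≤ (y / 2) ^ n / (Nat.factorial n : ℝ) * (1 - (y / 2) ^ 2)⁻¹ := by
  refine hasSum_le (fun m => ?_) (summable_besselI n hy).hasSum
    ((hasSum_geometric_of_lt_one (sq_nonneg (y / 2)) (by nlinarith)).mul_left _)
  rw [pow_add, pow_mul, div_mul_eq_mul_div]
  have h1 : (Nat.factorial n : ℝ) ≤ Nat.factorial (n + m) := by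
    exact_mod_cast Nat.factorial_le (by omega)
  have h2 : (1 : ℝ) ≤ Nat.factorial m := by exact_mod_cast Nat.factorial_pos m
  gcongr
  nlinarith [(Nat.cast_nonneg (Nat.factorial (n + m)) : (0 : ℝ) ≤ _)]

lemma besselK_nonneg (n : ℕ) (x : ℝ) : 0 ≤ besselK n x :=
  setIntegral_nonneg measurableSet_Ioi fun t _ => by positivity

lemma cosh_le_exp {t : ℝ} (ht : 0 ≤ t) : cosh t ≤ exp t := by
  rw [cosh_eq]
  have : exp (-t) ≤ exp t := exp_le_exp.2 (by linarith)
  linarith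

lemma le_cosh (t : ℝ) : t ≤ cosh t := by
  by_cases ht : 0 ≤ t
  · exact (self_le_sinh_iff.2 ht).trans (sinh_lt_cosh t).le
  · linarith [cosh_pos t]

lemma besselI_mul_besselK_le (n : ℕ) {x y : ℝ} (hy : 0 ≤ y) (hxy : y < x) :
    besselI n y * besselK n x ≤ 1 / (x - y) := by
  have hc : 0 < x - y := by linarith
  rw [besselK, ← integral_const_mul]
  calc _ ≤ ∫ t in Set.Ioi (0 : ℝ), exp (-(x - y) * t) := by
        refine integral_mono_of_nonneg (.of_forall fun t => ?_)
          (integrableOn_exp_mul_Ioi (by linarith) 0) ?_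
        · exact mul_nonneg (besselI_nonneg n hy) (by positivity)
        · refine (ae_restrict_mem measurableSet_Ioi).mono fun t (ht : 0 < t) => ?_
          calc besselI n y * (exp (-x * cosh t) * cosh (n * t))
              ≤ besselI n y * (exp (-x * cosh t) * exp (n * t)) := by
                have := besselI_nonneg n hy
                gcongr
                exact cosh_le_exp (by positivity)
            _ = exp (-x * cosh t) * (besselI n y * exp (n * t)) := by ring
            _ ≤ exp (-x * cosh t) * exp (y * cosh t) := by
                gcongr
                exact besselI_mul_exp_le n hy t
            _ = exp (-(x - y) * cosh t) := by rw [← exp_add]; ring_nf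
            _ ≤ exp (-(x - y) * t) := exp_le_exp.2 (by nlinarith [le_cosh t])
    _ = 1 / (x - y) := by
        rw [integral_exp_mul_Ioi (by linarith), mul_zero, exp_zero, neg_div_neg_eq]

lemma integrableOn_pow_mul_exp_neg_mul (k : ℕ) {a : ℝ} (ha : 0 < a) :
    IntegrableOn (fun u : ℝ => u ^ k * exp (-(a * u))) (Set.Ioi 0) := by
  have h := integrableOn_rpow_mul_exp_neg_mul_rpow (p := 1) (s := k) (b := a)
    (by have := (Nat.cast_nonneg k : (0 : ℝ) ≤ k); linarith) one_pos ha
  simpa using h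

lemma integral_pow_mul_exp_neg_mul (k : ℕ) {a : ℝ} (ha : 0 < a) :
    ∫ u in Set.Ioi (0 : ℝ), u ^ k * exp (-(a * u)) = (Nat.factorial k : ℝ) / a ^ (k + 1) := by
  have h := integral_rpow_mul_exp_neg_mul_Ioi (a := k + 1) (r := a) (by positivity) ha
  rw [Gamma_nat_eq_factorial] at h
  simp only [add_sub_cancel_right, rpow_natCast] at h
  rw [h]
  have : ((k : ℝ) + 1) = ((k + 1 : ℕ) : ℝ) := by push_cast; rfl
  rw [this, rpow_natCast, div_pow, one_pow]
  ring

lemma integrableOn_pow_mul_exp_neg_add_inv (k : ℕ) {a : ℝ} (ha : 0 < a) :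
    IntegrableOn (fun u : ℝ => u ^ k * exp (-(a * u)) * exp (-(a / u))) (Set.Ioi 0) := by
  refine (integrableOn_pow_mul_exp_neg_mul k ha).mono' (by fun_prop) ?_
  refine (ae_restrict_mem measurableSet_Ioi).mono fun u (hu : 0 < u) => ?_
  rw [norm_of_nonneg (by positivity)]
  refine mul_le_of_le_one_right (by positivity) (exp_le_one_iff.2 ?_)
  have : 0 < a / u := by positivity
  linarith

/-- The representation of `K_{k+1}` obtained from the substitution `u = exp t`. -/
lemma besselK_eq_integral (k : ℕ) {x : ℝ} (hx : 0 < x) :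
    besselK (k + 1) x = 1 / 2 * ∫ u in Set.Ioi (0 : ℝ),
      u ^ k * exp (-(x / 2 * u)) * exp (-(x / 2 / u)) := by
  set h : ℝ → ℝ := fun t => exp (-x * cosh t + (k + 1) * t) with hh
  have hpt : ∀ t ∈ (Set.univ : Set ℝ), |exp t| • (exp t ^ k * exp (-(x / 2 * exp t))
      * exp (-(x / 2 / exp t))) = h t := by
    intro t _
    simp only [hh]
    rw [abs_of_pos (exp_pos t), smul_eq_mul, ← exp_nat_mul, ← exp_add, ← exp_add, ← exp_add,
      cosh_eq, div_eq_mul_inv (x / 2), ← exp_neg]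
    congr 1; ring
  have himg : exp '' Set.univ = Set.Ioi 0 := by rw [Set.image_univ, range_exp]
  have hderiv : ∀ t ∈ (Set.univ : Set ℝ), HasDerivWithinAt exp (exp t) Set.univ t :=
    fun t _ => (hasDerivAt_exp t).hasDerivWithinAt
  have hint : Integrable h := by
    have := (integrableOn_image_iff_integrableOn_abs_deriv_smul MeasurableSet.univ hderiv
      exp_injective.injOn _).1 (himg ▸ integrableOn_pow_mul_exp_neg_add_inv k (half_pos hx))
    exact integrableOn_univ.1 (this.congr_fun hpt MeasurableSet.univ)
  have hval : ∫ u in Set.Ioi (0 : ℝ), u ^ k * exp (-(x / 2 * u)) * exp (-(x / 2 / u))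
      = ∫ t, h t := by
    rw [← himg, integral_image_eq_integral_abs_deriv_smul MeasurableSet.univ hderiv
      exp_injective.injOn, setIntegral_congr_fun MeasurableSet.univ hpt, setIntegral_univ]
  have hneg : ∫ t in Set.Ioi (0 : ℝ), h (-t) = ∫ t in Set.Iic (0 : ℝ), h t := by
    simp
  rw [hval, ← intervalIntegral.integral_Iic_add_Ioi (b := 0) hint.integrableOn hint.integrableOn,
    ← hneg, ← integral_add hint.comp_neg.integrableOn hint.integrableOn, ← integral_const_mul,
    besselK]
  refine integral_congr_ae (.of_forall fun t => ?_)
  simp only [hh, cosh_neg, exp_add]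
  rw [cosh_eq (((k + 1 : ℕ) : ℝ) * t)]
  push_cast
  ring_nf

lemma one_sub_exp_neg_le (y : ℝ) (hy : 0 < y) : 1 - exp (-y) ≤ 2 * y / (1 + y) := by
  rw [le_div_iff₀ (by linarith)]
  have h1 := add_one_le_exp (-y)
  have h2 := exp_pos (-y)
  by_cases h : y ≤ 1 <;> nlinarith

lemma integral_exp_mul_one_sub_exp_le {a : ℝ} (ha : 0 < a) (ha2 : a ≤ 1 / 2) :
    ∫ u in Set.Ioi (0 : ℝ), exp (-(a * u)) * (1 - exp (-(a / u))) ≤ 16 / 3 * a * log (1 / a) := by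
  have ha1 : 0 < 1 - a ^ 2 := by nlinarith
  set F : ℝ → ℝ := fun u => 2 * a / (1 - a ^ 2) * log ((a + u) / (1 + a * u)) with hF
  have hderiv : ∀ u ∈ Set.Ici (0 : ℝ),
      HasDerivAt F (2 * a / ((a + u) * (1 + a * u))) u := by
    intro u (hu : 0 ≤ u)
    have h1 : 0 < a + u := by linarith
    have h2 : 0 < 1 + a * u := by positivity
    have hd := ((((hasDerivAt_id u).const_add a).div
      (((hasDerivAt_id u).const_mul a).const_add 1) h2.ne').log
        (div_pos h1 h2).ne').const_mul (2 * a / (1 - a ^ 2))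
    refine hd.congr_deriv ?_
    simp only [id, Pi.div_apply]
    field_simp
    ring
  have hlim : Tendsto F atTop (nhds (2 * a / (1 - a ^ 2) * log (1 / a))) := by
    refine Tendsto.const_mul _ (Tendsto.log ?_ (by positivity))
    have h0 : Tendsto (fun u : ℝ => (a * u⁻¹ + 1) / (u⁻¹ + a)) atTop (nhds ((a * 0 + 1) / (0 + a))) :=
      ((tendsto_inv_atTop_zero.const_mul a).add_const 1).div
        (tendsto_inv_atTop_zero.add_const a) (by simpa using ha.ne')
    simp only [mul_zero, zero_add] at h0
    refine h0.congr' ((eventually_gt_atTop 0).mono fun u hu => ?_)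
    field_simp
  have hpos : ∀ u ∈ Set.Ioi (0 : ℝ), 0 ≤ 2 * a / ((a + u) * (1 + a * u)) := by
    intro u (hu : 0 < u)
    positivity
  have hI := integrableOn_Ioi_deriv_of_nonneg' hderiv hpos hlim
  have hV := integral_Ioi_of_hasDerivAt_of_nonneg' hderiv hpos hlim
  calc _ ≤ ∫ u in Set.Ioi (0 : ℝ), 2 * a / ((a + u) * (1 + a * u)) := by
        refine integral_mono_of_nonneg ?_ hI ?_
        · refine (ae_restrict_mem measurableSet_Ioi).mono fun u (hu : 0 < u) => ?_
          have : 0 < a / u := by positivity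
          exact mul_nonneg (exp_pos _).le (sub_nonneg.2 (exp_le_one_iff.2 (by linarith)))
        · refine (ae_restrict_mem measurableSet_Ioi).mono fun u (hu : 0 < u) => ?_
          have h1 : exp (-(a * u)) ≤ 1 / (1 + a * u) := by
            rw [exp_neg, ← one_div]
            gcongr
            linarith [add_one_le_exp (a * u)]
          have h2 := one_sub_exp_neg_le (a / u) (by positivity)
          calc _ ≤ exp (-(a * u)) * (2 * (a / u) / (1 + a / u)) := by
                have := (exp_pos (-(a * u))).le
                simp only
                gcongr
            _ ≤ 1 / (1 + a * u) * (2 * (a / u) / (1 + a / u)) := by gcongr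
            _ = _ := by field_simp; ring
    _ = 2 * a / (1 - a ^ 2) * (2 * log (1 / a)) := by
        rw [hV]
        simp only [hF, add_zero, mul_zero, div_one, one_div, log_inv]
        ring
    _ ≤ 2 * a / (3 / 4) * (2 * log (1 / a)) := by
        have : 0 ≤ log (1 / a) := log_nonneg (by rw [le_div_iff₀ ha]; linarith)
        gcongr
        nlinarith
    _ = _ := by ring

/-- The integral representing `2 K_{k+1}(2a)`, compared with its leading term as `a → 0`. -/
lemma integral_pow_mul_exp_neg_add_inv_bounds (k : ℕ) {a : ℝ} (ha : 0 < a) (ha2 : a ≤ 1 / 2) :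
    (Nat.factorial k : ℝ) / a ^ (k + 1) * (1 - a ^ 2 * (16 / 3 * log (1 / a) + 1)) ≤
        ∫ u in Set.Ioi (0 : ℝ), u ^ k * exp (-(a * u)) * exp (-(a / u)) ∧
      ∫ u in Set.Ioi (0 : ℝ), u ^ k * exp (-(a * u)) * exp (-(a / u)) ≤
        (Nat.factorial k : ℝ) / a ^ (k + 1) := by
  have hl : 0 ≤ log (1 / a) := log_nonneg (by rw [le_div_iff₀ ha]; linarith)
  have hI := integrableOn_pow_mul_exp_neg_mul k ha
  have hJ := integrableOn_pow_mul_exp_neg_add_inv k ha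
  have hle : ∀ u ∈ Set.Ioi (0 : ℝ), exp (-(a / u)) ≤ 1 := by
    intro u (hu : 0 < u)
    have : 0 < a / u := by positivity
    exact exp_le_one_iff.2 (by linarith)
  constructor
  · have hsub : ∫ u in Set.Ioi (0 : ℝ), u ^ k * (exp (-(a * u)) * (1 - exp (-(a / u)))) ≤
        (Nat.factorial k : ℝ) / a ^ (k + 1) * (a ^ 2 * (16 / 3 * log (1 / a) + 1)) := by
      rcases k with _ | k
      · simp only [pow_zero, one_mul, Nat.factorial_zero, Nat.cast_one, zero_add, pow_one]
        refine (integral_exp_mul_one_sub_exp_le ha ha2).trans ?_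
        have : 1 / a * (a ^ 2 * (16 / 3 * log (1 / a) + 1)) = 16 / 3 * a * log (1 / a) + a := by
          field_simp
        linarith
      · calc _ ≤ ∫ u in Set.Ioi (0 : ℝ), a * (u ^ k * exp (-(a * u))) := by
              refine integral_mono_of_nonneg ?_
                ((integrableOn_pow_mul_exp_neg_mul k ha).const_mul a) ?_
              · refine (ae_restrict_mem measurableSet_Ioi).mono fun u hu => ?_
                have hu' : (0 : ℝ) < u := hu
                have := sub_nonneg.2 (hle u hu)
                simp only [Pi.zero_apply]
                positivity
              · refine (ae_restrict_mem measurableSet_Ioi).mono fun u (hu : 0 < u) => ?_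
                have h1 : 1 - exp (-(a / u)) ≤ a / u := by linarith [add_one_le_exp (-(a / u))]
                calc _ ≤ u ^ (k + 1) * (exp (-(a * u)) * (a / u)) := by
                      simp only
                      gcongr
                  _ = _ := by field_simp; ring
          _ = (Nat.factorial k : ℝ) / a ^ (k + 1 + 1) * a ^ 2 * 1 := by
              rw [integral_const_mul, integral_pow_mul_exp_neg_mul k ha]
              field_simp; ring
          _ ≤ (Nat.factorial (k + 1) : ℝ) / a ^ (k + 1 + 1) * a ^ 2
                * (16 / 3 * log (1 / a) + 1) := by
              gcongr
              · omega
              · linarith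
          _ = _ := by ring
    have heq : ∫ u in Set.Ioi (0 : ℝ), u ^ k * (exp (-(a * u)) * (1 - exp (-(a / u)))) =
        (Nat.factorial k : ℝ) / a ^ (k + 1)
          - ∫ u in Set.Ioi (0 : ℝ), u ^ k * exp (-(a * u)) * exp (-(a / u)) := by
      rw [← integral_pow_mul_exp_neg_mul k ha, ← integral_sub hI hJ]
      congr 1 with u
      ring
    linarith
  · rw [← integral_pow_mul_exp_neg_mul k ha]
    refine setIntegral_mono_on hJ hI measurableSet_Ioi fun u hu => ?_
    have hu' : (0 : ℝ) < u := hu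
    exact mul_le_of_le_one_right (by positivity) (hle u hu)

lemma abs_besselI_mul_besselK_sub_le {b l : ℝ} (hb : b ∈ Set.Ioo (0 : ℝ) 1) (hl : 0 < l)
    (hl1 : l ≤ 1) (k : ℕ) :
    |besselI (k + 1) (l * b) * besselK (k + 1) l - b ^ (k + 1) / (2 * (k + 1 : ℕ))| ≤
      3 * max |log l| 1 * l ^ 2 := by
  obtain ⟨hb0, hb1⟩ := hb
  set M := max |log l| 1
  have hM1 : 1 ≤ M := le_max_right _ _
  obtain ⟨hK1, hK2⟩ := integral_pow_mul_exp_neg_add_inv_bounds k (half_pos hl) (by linarith)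
  have hKe := besselK_eq_integral k hl
  set J := ∫ u in Set.Ioi (0 : ℝ), u ^ k * exp (-(l / 2 * u)) * exp (-(l / 2 / u))
  have hy : 0 ≤ l * b := by positivity
  have hylt : l * b < 1 := by nlinarith
  have hI1 := le_besselI (k + 1) hy
  have hI2 := besselI_le (k + 1) hy (by linarith)
  have hlog : log (1 / (l / 2)) ≤ 2 * M := by
    have h2 : log (1 / (l / 2)) = log 2 - log l := by
      rw [← log_div two_ne_zero hl.ne']; congr 1; field_simp
    have := neg_le_abs (log l)
    have := le_max_left |log l| 1
    have := log_two_lt_d9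
    linarith
  set G := (Nat.factorial k : ℝ) / (l / 2) ^ (k + 1)
  set H := (l * b / 2) ^ (k + 1) / (Nat.factorial (k + 1) : ℝ)
  have hG : 0 < G := by positivity
  have hH : 0 < H := by positivity
  have hHG : b ^ (k + 1) / (2 * (k + 1 : ℕ)) = 1 / 2 * (H * G) := by
    simp only [G, H, Nat.factorial_succ, Nat.cast_mul, mul_pow, div_pow]
    field_simp
  have hsmall : b ^ (k + 1) / (2 * (k + 1 : ℕ)) ≤ 1 := by
    refine div_le_one_of_le₀ ?_ (by positivity)
    have := pow_le_one₀ hb0.le hb1.le (n := k + 1)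
    push_cast
    nlinarith [(Nat.cast_nonneg k : (0 : ℝ) ≤ k)]
  have hP : (1 - (l * b / 2) ^ 2)⁻¹ ≤ 1 + l ^ 2 := by
    have hq : (l * b / 2) ^ 2 ≤ l ^ 2 / 4 := by nlinarith [mul_le_mul_of_nonneg_left hb1.le hl.le]
    rw [inv_le_comm₀ (by nlinarith) (by positivity)]
    have : (1 + l ^ 2)⁻¹ ≤ 1 - l ^ 2 / 4 := by
      rw [inv_le_iff_one_le_mul₀ (by positivity)]
      nlinarith [mul_nonneg (sq_nonneg l) (sub_nonneg.2 (pow_le_one₀ hl.le hl1 (n := 2)))]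
    linarith
  have hJlow : G * (1 - 3 * M * l ^ 2) ≤ J := by
    refine le_trans ?_ hK1
    refine mul_le_mul_of_nonneg_left ?_ hG.le
    nlinarith [mul_nonneg (sq_nonneg l) (sub_nonneg.2 hlog),
      mul_nonneg (sq_nonneg l) (sub_nonneg.2 hM1)]
  have hJ0 : 0 ≤ J := by
    have := besselK_nonneg (k + 1) l
    linarith
  rw [hKe, hHG] at *
  have hup : besselI (k + 1) (l * b) * J ≤ H * (1 + l ^ 2) * G :=
    mul_le_mul (hI2.trans (by gcongr)) hK2 hJ0 (by positivity)
  have hlow : H * (G * (1 - 3 * M * l ^ 2)) ≤ besselI (k + 1) (l * b) * J :=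
    (mul_le_mul_of_nonneg_left hJlow hH.le).trans (mul_le_mul_of_nonneg_right hI1 hJ0)
  have hl2 : l ^ 2 ≤ 3 * M * l ^ 2 := by nlinarith [sq_nonneg l]
  have hHG0 : 0 < H * G := by positivity
  rw [abs_le]
  constructor <;> nlinarith [mul_le_mul_of_nonneg_right hsmall (hl2.trans' (sq_nonneg l)),
    mul_le_mul_of_nonneg_left hl2 hHG0.le]

/-- uniform-in-`n` bound `|I_n(λb)K_n(λ) − bⁿ/(2n)| ≤ C max(|log λ|,1) λ²`. -/
theorem besselIK_mixed_approx (b : ℝ) (hb : b ∈ Set.Ioo (0:ℝ) 1) :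
    ∃ C : ℝ, 0 < C ∧ ∀ l : ℝ, 0 < l → ∀ n : ℕ, 1 ≤ n →
      |besselI n (l * b) * besselK n l - b ^ n / (2 * n)| ≤
        C * max |Real.log l| 1 * l ^ 2 := by
  have hb1 : 0 < 1 - b := sub_pos.2 hb.2
  refine ⟨3 + 1 / (1 - b), by positivity, fun l hl n hn => ?_⟩
  have hM : 1 ≤ max |log l| 1 := le_max_right _ _
  rcases le_or_gt l 1 with hl1 | hl1
  · obtain ⟨k, rfl⟩ := Nat.exists_eq_add_of_le' hn
    refine (abs_besselI_mul_besselK_sub_le hb hl hl1 k).trans ?_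
    gcongr
    simpa using hb1.le
  · have hy : 0 ≤ l * b := mul_nonneg hl.le hb.1.le
    have h1 : besselI n (l * b) * besselK n l ≤ 1 / (1 - b) :=
      (besselI_mul_besselK_le n hy (by nlinarith)).trans
        (one_div_le_one_div_of_le hb1 (by nlinarith))
    have h0 := mul_nonneg (besselI_nonneg n hy) (besselK_nonneg n l)
    have hn' : (1 : ℝ) ≤ n := by exact_mod_cast hn
    have h2 : b ^ n / (2 * n) ≤ 1 :=
      div_le_one_of_le₀ (by linarith [pow_le_one₀ hb.1.le hb.2.le (n := n)]) (by positivity)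
    have h3 : 0 ≤ b ^ n / (2 * n) := div_nonneg (pow_nonneg hb.1.le n) (by positivity)
    have h4 : 0 < 1 / (1 - b) := by positivity
    calc _ ≤ (3 + 1 / (1 - b)) * 1 * 1 := by rw [abs_le]; constructor <;> linarith
      _ ≤ _ := by
        gcongr
        exact one_le_pow₀ hl1.le
end

section
/- Let b∈(0,1). There exists Ñ(b)∈ℕ such that for every integer n ≥ Ñ(b) one has 1 + bⁿ − n·(1−b²)/2 < 0, and for each sign σ∈{+,−}, Ω_n^σ(λ,b) → Ω_n^σ(b) as λ→0⁺, where Ω_n^±(b) := (1−b²)/4 ± (1/(2n))·√( (n·(1−b²)/2 − 1)² − b^{2n} ); i.e. as λ→0 the spectrum converges to that of the Euler equations. -/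
open Real MeasureTheory Filter

/-- `I_n(x) / xⁿ` as a power series. -/
noncomputable def besselIReg (n : ℕ) (x : ℝ) : ℝ :=
  ∑' m : ℕ, (1 / 2) ^ (n + 2 * m) * x ^ (2 * m) /
    ((Nat.factorial m : ℝ) * (Nat.factorial (n + m) : ℝ))

theorem besselI_eq_pow_mul (n : ℕ) (x : ℝ) : besselI n x = x ^ n * besselIReg n x := by
  unfold besselI besselIReg
  rw [← tsum_mul_left]
  congr 1
  ext m
  rw [div_eq_mul_one_div x 2, mul_pow, pow_add x]
  ring

theorem tendsto_besselIReg (n : ℕ) :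
    Tendsto (besselIReg n) (nhds 0) (nhds ((1 / 2) ^ n / (Nat.factorial n : ℝ))) := by
  have key : ∑' m : ℕ, (if m = 0 then (1 / 2 : ℝ) ^ n / (Nat.factorial n : ℝ) else 0)
      = (1 / 2) ^ n / (Nat.factorial n : ℝ) := tsum_ite_eq 0 _
  rw [← key]
  unfold besselIReg
  refine tendsto_tsum_of_dominated_convergence
    (bound := fun m : ℕ => 1 / (Nat.factorial m : ℝ)) ?_ ?_ ?_
  · simpa using Real.summable_pow_div_factorial 1
  · intro m
    have hc : Continuous fun x : ℝ => (1 / 2 : ℝ) ^ (n + 2 * m) * x ^ (2 * m) /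
        ((Nat.factorial m : ℝ) * (Nat.factorial (n + m) : ℝ)) := by fun_prop
    convert hc.tendsto 0 using 2
    rcases m with _ | m <;> simp
  · filter_upwards [Metric.ball_mem_nhds (0 : ℝ) one_pos] with x hx m
    rw [mem_ball_zero_iff] at hx
    have h1 : (1 : ℝ) ≤ (Nat.factorial (n + m) : ℝ) := by
      exact_mod_cast Nat.one_le_iff_ne_zero.2 (Nat.factorial_ne_zero _)
    have h0 : (0 : ℝ) < (Nat.factorial m : ℝ) := by positivity
    rw [norm_div, norm_mul, norm_pow, norm_pow, Real.norm_of_nonneg (by positivity : (0 : ℝ) ≤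
      (Nat.factorial m : ℝ) * (Nat.factorial (n + m) : ℝ))]
    have h2 : ‖(1 / 2 : ℝ)‖ ^ (n + 2 * m) ≤ 1 := pow_le_one₀ (norm_nonneg _) (by norm_num)
    have h3 : ‖x‖ ^ (2 * m) ≤ 1 := pow_le_one₀ (norm_nonneg _) hx.le
    apply div_le_div₀ zero_le_one (mul_le_one₀ h2 (by positivity) h3) h0
    exact le_mul_of_one_le_right h0.le h1

/-- The integrand of `x ^ (k + 1) * K_{k+1}(x)` after the substitution `u = x eᵗ`. -/
noncomputable def besselKIntegrand (k : ℕ) (x u : ℝ) : ℝ :=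
  Real.exp (-(u + x ^ 2 / u) / 2) * ((u ^ (k + 1) + x ^ (2 * (k + 1)) / u ^ (k + 1)) / 2) / u

theorem pow_mul_besselK (k : ℕ) {x : ℝ} (hx : 0 < x) :
    x ^ (k + 1) * besselK (k + 1) x = ∫ u in Set.Ioi x, besselKIntegrand k x u := by
  have himage : (fun t : ℝ => x * Real.exp t) '' Set.Ioi 0 = Set.Ioi x := by
    ext u
    simp only [Set.mem_image, Set.mem_Ioi]
    constructor
    · rintro ⟨t, ht, rfl⟩
      exact lt_mul_of_one_lt_right hx (Real.one_lt_exp_iff.2 ht)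
    · intro hu
      refine ⟨Real.log (u / x), Real.log_pos ((one_lt_div hx).2 hu), ?_⟩
      rw [Real.exp_log (div_pos (hx.trans hu) hx)]
      field_simp
  rw [← himage, integral_image_eq_integral_abs_deriv_smul (f' := fun t => x * Real.exp t)
    measurableSet_Ioi (fun t _ => ((Real.hasDerivAt_exp t).const_mul x).hasDerivWithinAt)
    (fun s _ t _ h => Real.exp_injective (mul_left_cancel₀ hx.ne' h)), besselK,
    ← integral_const_mul]
  congr 1
  ext t
  have hpos : 0 < x * Real.exp t := by positivity
  have harg : -(x * Real.exp t + x ^ 2 / (x * Real.exp t)) / 2 = -x * Real.cosh t := by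
    rw [Real.cosh_eq, Real.exp_neg]
    field_simp
  have hcosh : ((x * Real.exp t) ^ (k + 1) + x ^ (2 * (k + 1)) / (x * Real.exp t) ^ (k + 1)) / 2
      = x ^ (k + 1) * Real.cosh (((k + 1 : ℕ) : ℝ) * t) := by
    rw [Real.cosh_eq, Real.exp_neg, Real.exp_nat_mul, mul_pow, two_mul, pow_add x (k + 1) (k + 1)]
    field_simp
  rw [smul_eq_mul, abs_of_pos hpos, besselKIntegrand, harg, hcosh]
  field_simp

theorem integral_pow_mul_exp_neg_half (k : ℕ) :
    ∫ u in Set.Ioi (0 : ℝ), u ^ k * Real.exp (-u / 2) = 2 ^ (k + 1) * (Nat.factorial k : ℝ) := by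
  have h := Real.integral_rpow_mul_exp_neg_mul_Ioi (a := (k : ℝ) + 1) (r := 1 / 2)
    (by positivity) (by norm_num)
  rw [Real.Gamma_nat_eq_factorial, add_sub_cancel_right, one_div_one_div] at h
  rw [← Nat.cast_add_one, Real.rpow_natCast] at h
  rw [← h]
  congr 1
  ext u
  rw [Real.rpow_natCast]
  congr 2
  ring

theorem integrableOn_pow_mul_exp_neg_half (k : ℕ) :
    IntegrableOn (fun u : ℝ => u ^ k * Real.exp (-u / 2)) (Set.Ioi 0) := by
  refine not_imp_comm.1 integral_undef ?_
  rw [integral_pow_mul_exp_neg_half]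
  positivity

theorem tendsto_pow_mul_besselK (k : ℕ) :
    Tendsto (fun x : ℝ => x ^ (k + 1) * besselK (k + 1) x) (nhdsWithin 0 (Set.Ioi 0))
      (nhds (2 ^ k * (Nat.factorial k : ℝ))) := by
  have hlim : ∫ u in Set.Ioi (0 : ℝ), u ^ k * Real.exp (-u / 2) / 2
      = 2 ^ k * (Nat.factorial k : ℝ) := by
    rw [integral_div, integral_pow_mul_exp_neg_half]
    ring
  rw [← hlim]
  have heq : ∀ᶠ x : ℝ in nhdsWithin 0 (Set.Ioi 0),
      ∫ u in Set.Ioi (0 : ℝ), (Set.Ioi x).indicator (besselKIntegrand k x) u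
        = x ^ (k + 1) * besselK (k + 1) x := by
    filter_upwards [self_mem_nhdsWithin] with x hx
    rw [pow_mul_besselK k hx, setIntegral_indicator measurableSet_Ioi,
      Set.inter_eq_right.2 (Set.Ioi_subset_Ioi (le_of_lt hx))]
  refine Tendsto.congr' heq ?_
  refine tendsto_integral_filter_of_dominated_convergence
    (fun u => u ^ k * Real.exp (-u / 2)) ?_ ?_ (integrableOn_pow_mul_exp_neg_half k) ?_
  · refine Eventually.of_forall fun x => ?_
    refine (Measurable.indicator ?_ measurableSet_Ioi).aestronglyMeasurable
    unfold besselKIntegrand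
    fun_prop
  · filter_upwards [self_mem_nhdsWithin] with x hx
    have hx : 0 < x := hx
    filter_upwards [ae_restrict_mem measurableSet_Ioi] with u hu
    have hu : 0 < u := hu
    by_cases hxu : u ∈ Set.Ioi x
    · rw [Set.indicator_of_mem hxu, besselKIntegrand, Real.norm_of_nonneg (by positivity)]
      have h1 : Real.exp (-(u + x ^ 2 / u) / 2) ≤ Real.exp (-u / 2) := by
        rw [Real.exp_le_exp]
        have : 0 ≤ x ^ 2 / u := by positivity
        linarith
      have h2 : x ^ (2 * (k + 1)) / u ^ (k + 1) ≤ u ^ (k + 1) := by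
        rw [div_le_iff₀ (by positivity), ← pow_add, ← two_mul]
        exact pow_le_pow_left₀ hx.le (le_of_lt hxu) _
      rw [div_le_iff₀ hu]
      calc Real.exp (-(u + x ^ 2 / u) / 2)
            * ((u ^ (k + 1) + x ^ (2 * (k + 1)) / u ^ (k + 1)) / 2)
          ≤ Real.exp (-u / 2) * u ^ (k + 1) := by
            gcongr
            linarith
        _ = u ^ k * Real.exp (-u / 2) * u := by ring
    · rw [Set.indicator_of_notMem hxu, norm_zero]
      positivity
  · filter_upwards [ae_restrict_mem measurableSet_Ioi] with u hu
    have hu : 0 < u := hu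
    have hc : Continuous fun x : ℝ => besselKIntegrand k x u := by
      unfold besselKIntegrand
      fun_prop
    have h0 : besselKIntegrand k 0 u = u ^ k * Real.exp (-u / 2) / 2 := by
      rw [besselKIntegrand, zero_pow two_ne_zero, zero_pow (by positivity), zero_div, add_zero,
        zero_div, add_zero]
      field_simp
      ring
    rw [← h0]
    refine Tendsto.congr' ?_ ((hc.tendsto 0).mono_left nhdsWithin_le_nhds)
    filter_upwards [nhdsWithin_le_nhds (Iio_mem_nhds hu)] with x hx
    rw [Set.indicator_of_mem (Set.mem_Ioi.2 hx)]

theorem tendsto_Lam {n : ℕ} (hn : n ≠ 0) (c : ℝ) :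
    Tendsto (fun l : ℝ => Lam n l c) (nhdsWithin 0 (Set.Ioi 0)) (nhds (c ^ n / (2 * n))) := by
  obtain ⟨k, rfl⟩ := Nat.exists_eq_succ_of_ne_zero hn
  have hmul : Tendsto (fun l : ℝ => l * c) (nhdsWithin 0 (Set.Ioi 0)) (nhds 0) := by
    have hc : Continuous fun l : ℝ => l * c := by fun_prop
    simpa using (hc.tendsto 0).mono_left nhdsWithin_le_nhds
  have h := (((tendsto_besselIReg (k + 1)).comp hmul).const_mul (c ^ (k + 1))).mul
    (tendsto_pow_mul_besselK k)
  convert h using 2 with l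
  · rw [Lam, besselI_eq_pow_mul, mul_pow, Function.comp_apply, Nat.succ_eq_add_one]
    ring
  · rw [Nat.factorial_succ, one_div_pow, pow_succ 2 k]
    push_cast
    field_simp

theorem tendsto_Om {n : ℕ} (hn : n ≠ 0) :
    Tendsto (Om n) (nhdsWithin 0 (Set.Ioi 0)) (nhds (1 / 2 - 1 / (2 * n))) := by
  change Tendsto (fun x => Om n x) _ _
  simpa [Lam, Om] using (tendsto_Lam one_ne_zero 1).sub (tendsto_Lam hn 1)

/-- convergence of the spectrum to the Euler spectrum as `λ → 0⁺`:
for `n ≥ Ñ(b)` one has `1 + bⁿ − n(1−b²)/2 < 0` and `Ω_n^±(λ,b) → Ω_n^±(b)`. -/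
theorem spectrum_continuity_euler (b : ℝ) (hb : b ∈ Set.Ioo (0:ℝ) 1) :
    ∃ N : ℕ, ∀ n : ℕ, N ≤ n →
      1 + b ^ n - n * (1 - b ^ 2) / 2 < 0 ∧
      Tendsto (fun l : ℝ => OmP n l b) (nhdsWithin 0 (Set.Ioi 0))
        (nhds ((1 - b ^ 2) / 4 +
          (1 / (2 * n)) * Real.sqrt ((n * (1 - b ^ 2) / 2 - 1) ^ 2 - b ^ (2 * n)))) ∧
      Tendsto (fun l : ℝ => OmM n l b) (nhdsWithin 0 (Set.Ioi 0))
        (nhds ((1 - b ^ 2) / 4 -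
          (1 / (2 * n)) * Real.sqrt ((n * (1 - b ^ 2) / 2 - 1) ^ 2 - b ^ (2 * n)))) := by
  obtain ⟨hb0, hb1⟩ := hb
  have hgap : 0 < 1 - b ^ 2 := by nlinarith
  obtain ⟨N, hN⟩ := exists_nat_gt (4 / (1 - b ^ 2))
  rw [div_lt_iff₀ hgap] at hN
  refine ⟨N, fun n hn => ?_⟩
  have hnN : (N : ℝ) ≤ n := by exact_mod_cast hn
  have hlarge : 4 < n * (1 - b ^ 2) := hN.trans_le (mul_le_mul_of_nonneg_right hnN hgap.le)
  have hn0 : n ≠ 0 := by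
    rintro rfl
    norm_num at hlarge
  have hnpos : (0 : ℝ) < n := by positivity
  have hscale : Tendsto (fun l : ℝ => l * b) (nhdsWithin 0 (Set.Ioi 0))
      (nhdsWithin 0 (Set.Ioi 0)) := by
    refine tendsto_nhdsWithin_iff.2 ⟨?_, ?_⟩
    · have hc : Continuous fun l : ℝ => l * b := by fun_prop
      simpa using (hc.tendsto 0).mono_left nhdsWithin_le_nhds
    · filter_upwards [self_mem_nhdsWithin] with l hl using mul_pos hl hb0
  have hO := tendsto_Om hn0
  have hOb := hO.comp hscale
  have hL1 := tendsto_Lam one_ne_zero b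
  have hLn := tendsto_Lam hn0 b
  have hB : Tendsto (fun l => Bfun n l b) (nhdsWithin 0 (Set.Ioi 0))
      (nhds ((1 - b ^ 2) * b / 2)) := by
    convert (hL1.const_mul (1 - b ^ 2)).add ((hO.sub hOb).const_mul b) using 2
    · rfl
    · push_cast
      ring
  have hD : Tendsto (fun l => Real.sqrt (Del n l b)) (nhdsWithin 0 (Set.Ioi 0))
      (nhds (b / n * Real.sqrt ((n * (1 - b ^ 2) / 2 - 1) ^ 2 - b ^ (2 * n)))) := by
    have h := (((((hO.add hOb).const_mul b).sub (hL1.const_mul (1 + b ^ 2))).pow 2).sub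
      ((hLn.pow 2).const_mul (4 * b ^ 2))).sqrt
    convert h using 2
    · rfl
    · rw [← Real.sqrt_sq (div_pos hb0 hnpos).le, ← Real.sqrt_mul (sq_nonneg _),
        mul_comm 2 n, pow_mul]
      congr 1
      push_cast
      field_simp
      ring
  refine ⟨?_, ?_, ?_⟩
  · have : b ^ n ≤ 1 := pow_le_one₀ hb0.le hb1.le
    linarith
  · convert (hB.add hD).div_const (2 * b) using 2
    · rfl
    · field_simp
      ring
  · convert (hB.sub hD).div_const (2 * b) using 2
    · rfl
    · field_simp
      ring
end

section
/- Let λ>0. There exists Ñ(λ)∈ℕ such that for every integer n ≥ Ñ(λ): Ω_n^+(λ,b) → Ω_n(λ) = I_1(λ)·K_1(λ) − I_n(λ)·K_n(λ) as b→0⁺, and Ω_n^−(λ,b) → (λ·n·K_1(λ) − n + 1)/(2n) as b→0⁺; i.e. as b→0 the upper branch of the spectrum converges to the simply-connected spectrum of the quasi-geostrophic shallow-water equations. -/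
open Real MeasureTheory Filter

theorem besselI_term_le (n m : ℕ) {x : ℝ} (hx : 0 ≤ x) :
    (x / 2) ^ (n + 2 * m) / ((m.factorial : ℝ) * ((n + m).factorial : ℝ)) ≤
      (x / 2) ^ n / n.factorial * (((x / 2) ^ 2) ^ m / m.factorial) := by
  have h : (n.factorial : ℝ) ≤ (n + m).factorial := by
    exact_mod_cast Nat.factorial_le (Nat.le_add_right n m)
  rw [pow_add, pow_mul, div_mul_div_comm, mul_comm (m.factorial : ℝ)]
  gcongr

theorem hasSum_exp_bound (n : ℕ) (x : ℝ) :
    HasSum (fun m : ℕ => (x / 2) ^ n / n.factorial * (((x / 2) ^ 2) ^ m / m.factorial))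
      ((x / 2) ^ n / n.factorial * Real.exp ((x / 2) ^ 2)) := by
  have h := NormedSpace.expSeries_div_hasSum_exp ((x / 2) ^ 2)
  rw [← Real.exp_eq_exp_ℝ] at h
  exact h.mul_left _

theorem besselI_summable (n : ℕ) {x : ℝ} (hx : 0 ≤ x) :
    Summable fun m : ℕ =>
      (x / 2) ^ (n + 2 * m) / ((m.factorial : ℝ) * ((n + m).factorial : ℝ)) :=
  Summable.of_nonneg_of_le (fun m => by positivity) (fun m => besselI_term_le n m hx)
    (hasSum_exp_bound n x).summable

theorem besselI_le_s16 (n : ℕ) {x : ℝ} (hx : 0 ≤ x) :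
    besselI n x ≤ (x / 2) ^ n / n.factorial * Real.exp ((x / 2) ^ 2) := by
  rw [← (hasSum_exp_bound n x).tsum_eq]
  exact (besselI_summable n hx).tsum_le_tsum (fun m => besselI_term_le n m hx)
    (hasSum_exp_bound n x).summable

theorem le_besselI_s16 (n : ℕ) {x : ℝ} (hx : 0 ≤ x) :
    (x / 2) ^ n / n.factorial ≤ besselI n x := by
  have h := (besselI_summable n hx).le_tsum 0 (fun m _ => by positivity)
  simpa [besselI] using h

theorem besselI_div_pow_tendsto (n : ℕ) :
    Tendsto (fun x : ℝ => besselI n x / (x / 2) ^ n) (nhdsWithin 0 (Set.Ioi 0))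
      (nhds (1 / n.factorial)) := by
  have hu : Tendsto (fun x : ℝ => 1 / (n.factorial : ℝ) * Real.exp ((x / 2) ^ 2))
      (nhdsWithin 0 (Set.Ioi 0)) (nhds (1 / n.factorial)) := by
    have h : Continuous fun x : ℝ => 1 / (n.factorial : ℝ) * Real.exp ((x / 2) ^ 2) := by
      fun_prop
    have h0 := (h.tendsto 0).mono_left (nhdsWithin_le_nhds (s := Set.Ioi 0))
    simpa using h0
  refine tendsto_of_tendsto_of_tendsto_of_le_of_le' tendsto_const_nhds hu ?_ ?_
  · filter_upwards [self_mem_nhdsWithin] with x hx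
    have hx : 0 < x := hx
    rw [le_div_iff₀ (by positivity)]
    calc _ = (x / 2) ^ n / n.factorial := by ring
      _ ≤ _ := le_besselI_s16 n hx.le
  · filter_upwards [self_mem_nhdsWithin] with x hx
    have hx : 0 < x := hx
    rw [div_le_iff₀ (by positivity)]
    calc _ ≤ _ := besselI_le_s16 n hx.le
      _ = _ := by ring

theorem integrableOn_gamma_nat (n : ℕ) :
    IntegrableOn (fun u : ℝ => Real.exp (-u) * u ^ n) (Set.Ioi 0) := by
  have h := Real.GammaIntegral_convergent (s := (n : ℝ) + 1) (by positivity)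
  simpa using h

theorem integral_gamma_nat (n : ℕ) :
    ∫ u in Set.Ioi (0 : ℝ), Real.exp (-u) * u ^ n = n.factorial := by
  have h := Real.Gamma_eq_integral (s := (n : ℝ) + 1) (by positivity)
  rw [Real.Gamma_nat_eq_factorial] at h
  simpa using h.symm

/-- The integrand of the representation
`K_{n+1}(x) (x/2)^{n+1} = (1/2) ∫_0^∞ exp(−x²/(4u)) exp(−u) uⁿ du`. -/
noncomputable def kernelK (n : ℕ) (x u : ℝ) : ℝ :=
  Real.exp (-(x ^ 2 / (4 * u))) * (Real.exp (-u) * u ^ n)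

theorem kernelK_pos (n : ℕ) (x : ℝ) {u : ℝ} (hu : 0 < u) : 0 < kernelK n x u := by
  unfold kernelK; positivity

theorem kernelK_le (n : ℕ) (x : ℝ) {u : ℝ} (hu : 0 < u) :
    kernelK n x u ≤ Real.exp (-u) * u ^ n := by
  unfold kernelK
  refine mul_le_of_le_one_left (by positivity) (Real.exp_le_one_iff.2 ?_)
  have : 0 ≤ x ^ 2 / (4 * u) := by positivity
  linarith

theorem measurable_kernelK (n : ℕ) (x : ℝ) : Measurable (kernelK n x) := by
  unfold kernelK; fun_prop

theorem integrableOn_kernelK (n : ℕ) (x : ℝ) : IntegrableOn (kernelK n x) (Set.Ioi 0) := by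
  refine (integrableOn_gamma_nat n).mono' (measurable_kernelK n x).aestronglyMeasurable ?_
  filter_upwards [ae_restrict_mem measurableSet_Ioi] with u hu
  rw [Real.norm_of_nonneg (kernelK_pos n x hu).le]
  exact kernelK_le n x hu

theorem integral_kernelK_le (n : ℕ) (x : ℝ) :
    ∫ u in Set.Ioi (0 : ℝ), kernelK n x u ≤ n.factorial := by
  rw [← integral_gamma_nat n]
  exact setIntegral_mono_on (integrableOn_kernelK n x) (integrableOn_gamma_nat n)
    measurableSet_Ioi fun u hu => kernelK_le n x hu

theorem integral_kernelK_pos (n : ℕ) (x : ℝ) :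
    0 < ∫ u in Set.Ioi (0 : ℝ), kernelK n x u := by
  rw [setIntegral_pos_iff_support_of_nonneg_ae _ (integrableOn_kernelK n x)]
  · have h : Function.support (kernelK n x) ∩ Set.Ioi 0 = Set.Ioi 0 :=
      Set.inter_eq_right.2 fun u hu => (kernelK_pos n x hu).ne'
    rw [h]
    simp
  · filter_upwards [ae_restrict_mem measurableSet_Ioi] with u hu
    exact (kernelK_pos n x hu).le

theorem integral_kernelK_tendsto (n : ℕ) :
    Tendsto (fun x => ∫ u in Set.Ioi (0 : ℝ), kernelK n x u) (nhdsWithin 0 (Set.Ioi 0))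
      (nhds n.factorial) := by
  rw [← integral_gamma_nat n]
  refine tendsto_integral_filter_of_dominated_convergence (fun u : ℝ => Real.exp (-u) * u ^ n)
    (Eventually.of_forall fun x => (measurable_kernelK n x).aestronglyMeasurable)
    (Eventually.of_forall fun x => ?_) (integrableOn_gamma_nat n)
    (Eventually.of_forall fun u => ?_)
  · filter_upwards [ae_restrict_mem measurableSet_Ioi] with u hu
    rw [Real.norm_of_nonneg (kernelK_pos n x hu).le]
    exact kernelK_le n x hu
  · have h : Continuous fun x : ℝ => kernelK n x u := by
      unfold kernelK; fun_prop
    have h0 := (h.tendsto 0).mono_left (nhdsWithin_le_nhds (s := Set.Ioi 0))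
    simpa [kernelK] using h0

theorem besselK_mul_pow (n : ℕ) {x : ℝ} (hx : 0 < x) :
    besselK (n + 1) x * (x / 2) ^ (n + 1) = (∫ u in Set.Ioi (0 : ℝ), kernelK n x u) / 2 := by
  set f : ℝ → ℝ := fun t => x / 2 * Real.exp t with hf
  have hder : ∀ t ∈ Set.univ, HasDerivWithinAt f (f t) Set.univ t := fun t _ =>
    ((Real.hasDerivAt_exp t).const_mul (x / 2)).hasDerivWithinAt
  have hinj : Set.InjOn f Set.univ := fun s _ t _ hst =>
    Real.exp_injective (mul_left_cancel₀ (by positivity) hst)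
  have himg : f '' Set.univ = Set.Ioi 0 := by
    ext u
    constructor
    · rintro ⟨t, -, rfl⟩
      exact mul_pos (half_pos hx) (Real.exp_pos t)
    · intro hu
      have hu : 0 < u := hu
      refine ⟨Real.log (u / (x / 2)), trivial, ?_⟩
      simp only [hf]
      rw [Real.exp_log (by positivity)]
      field_simp
  have hfun : ∀ t, |f t| • kernelK n x (f t) =
      (x / 2) ^ (n + 1) * (Real.exp (-x * Real.cosh t) * Real.exp ((n + 1 : ℕ) * t)) := by
    intro t
    have hpos : 0 < f t := mul_pos (half_pos hx) (Real.exp_pos t)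
    have harg : -(x ^ 2 / (4 * f t)) + -f t = -x * Real.cosh t := by
      simp only [hf]
      rw [Real.cosh_eq, Real.exp_neg]
      field_simp
      ring
    rw [abs_of_pos hpos, smul_eq_mul, kernelK, ← mul_assoc (Real.exp _), ← Real.exp_add, harg,
      Real.exp_nat_mul]
    simp only [hf]
    ring
  have hint := integrableOn_kernelK n x
  have hval := integral_image_eq_integral_abs_deriv_smul MeasurableSet.univ hder hinj
    (kernelK n x)
  rw [← himg, integrableOn_image_iff_integrableOn_abs_deriv_smul MeasurableSet.univ hder hinj]
    at hint
  rw [himg] at hval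
  simp only [hfun, Measure.restrict_univ, integrableOn_univ] at hint hval
  rw [integral_const_mul] at hval
  have hg : Integrable fun t : ℝ =>
      Real.exp (-x * Real.cosh t) * Real.exp ((n + 1 : ℕ) * t) := by
    rwa [integrable_const_mul_iff (IsUnit.mk0 _ (by positivity))] at hint
  set g : ℝ → ℝ := fun t => Real.exp (-x * Real.cosh t) * Real.exp ((n + 1 : ℕ) * t) with hgdef
  have hsplit : ∫ t, g t = (∫ t in Set.Ioi (0 : ℝ), g (-t)) + ∫ t in Set.Ioi (0 : ℝ), g t := by
    rw [integral_comp_neg_Ioi, neg_zero,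
      intervalIntegral.integral_Iic_add_Ioi hg.integrableOn hg.integrableOn]
  have hK : besselK (n + 1) x = (∫ t, g t) / 2 := by
    rw [hsplit, ← integral_add hg.comp_neg.integrableOn hg.integrableOn, besselK,
      ← integral_div]
    congr 1
    ext t
    simp only [hgdef]
    rw [Real.cosh_neg, Real.cosh_eq ((n + 1 : ℕ) * t), mul_neg]
    ring
  rw [hval, hK]
  ring

theorem besselK_mul_pow_tendsto (n : ℕ) :
    Tendsto (fun x : ℝ => besselK (n + 1) x * (x / 2) ^ (n + 1)) (nhdsWithin 0 (Set.Ioi 0))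
      (nhds (n.factorial / 2)) := by
  refine ((integral_kernelK_tendsto n).div_const 2).congr' ?_
  filter_upwards [self_mem_nhdsWithin] with x hx
  exact (besselK_mul_pow n hx).symm

theorem besselK_mul_pow_le (n : ℕ) {x : ℝ} (hx : 0 < x) :
    besselK (n + 1) x * (x / 2) ^ (n + 1) ≤ n.factorial / 2 := by
  rw [besselK_mul_pow n hx]
  linarith [integral_kernelK_le n x]

theorem besselK_pos (n : ℕ) {x : ℝ} (hx : 0 < x) : 0 < besselK (n + 1) x := by
  have h := besselK_mul_pow n hx
  have hI := integral_kernelK_pos n x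
  refine pos_of_mul_pos_left (b := (x / 2) ^ (n + 1)) ?_ (by positivity)
  rw [h]
  positivity

theorem besselI_mul_besselK_tendsto (n : ℕ) :
    Tendsto (fun x : ℝ => besselI (n + 1) x * besselK (n + 1) x) (nhdsWithin 0 (Set.Ioi 0))
      (nhds (1 / (2 * (n + 1 : ℕ)))) := by
  have h := (besselI_div_pow_tendsto (n + 1)).mul (besselK_mul_pow_tendsto n)
  have hlim : 1 / ((n + 1).factorial : ℝ) * (n.factorial / 2) = 1 / (2 * (n + 1 : ℕ)) := by
    rw [Nat.factorial_succ]
    push_cast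
    field_simp
  rw [hlim] at h
  refine h.congr' ?_
  filter_upwards [self_mem_nhdsWithin] with x hx
  have hx : 0 < x := hx
  field_simp

theorem besselI_mul_besselK_le_s16 (n : ℕ) {x : ℝ} (hx : 0 < x) :
    besselI (n + 1) x * besselK (n + 1) x ≤
      Real.exp ((x / 2) ^ 2) / 2 * (1 / ((n : ℝ) + 1)) := by
  calc besselI (n + 1) x * besselK (n + 1) x
      ≤ (x / 2) ^ (n + 1) / (n + 1).factorial * Real.exp ((x / 2) ^ 2) * besselK (n + 1) x :=
        mul_le_mul_of_nonneg_right (besselI_le_s16 _ hx.le) (besselK_pos n hx).le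
    _ = Real.exp ((x / 2) ^ 2) / (n + 1).factorial *
          (besselK (n + 1) x * (x / 2) ^ (n + 1)) := by ring
    _ ≤ Real.exp ((x / 2) ^ 2) / (n + 1).factorial * (n.factorial / 2) := by
        gcongr
        exact besselK_mul_pow_le n hx
    _ = _ := by
        rw [Nat.factorial_succ]
        push_cast
        field_simp

theorem tendsto_mul_left_nhdsGT_zero {l : ℝ} (hl : 0 < l) :
    Tendsto (fun b : ℝ => l * b) (nhdsWithin 0 (Set.Ioi 0)) (nhdsWithin 0 (Set.Ioi 0)) := by
  refine tendsto_nhdsWithin_iff.2 ⟨?_, ?_⟩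
  · have h : Continuous fun b : ℝ => l * b := by fun_prop
    simpa using (h.tendsto 0).mono_left (nhdsWithin_le_nhds (s := Set.Ioi 0))
  · filter_upwards [self_mem_nhdsWithin] with b hb
    exact mul_pos hl hb

theorem Om_tendsto (n : ℕ) {l : ℝ} (hl : 0 < l) :
    Tendsto (fun b : ℝ => Om (n + 1) (l * b)) (nhdsWithin 0 (Set.Ioi 0))
      (nhds (1 / 2 - 1 / (2 * (n + 1 : ℕ)))) := by
  have h := ((besselI_mul_besselK_tendsto 0).sub (besselI_mul_besselK_tendsto n)).comp
    (tendsto_mul_left_nhdsGT_zero hl)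
  simpa [Om, Function.comp_def] using h

theorem Lam_div_tendsto {l : ℝ} (hl : 0 < l) :
    Tendsto (fun b : ℝ => Lam 1 l b / b) (nhdsWithin 0 (Set.Ioi 0))
      (nhds (l * besselK 1 l / 2)) := by
  have h := (((besselI_div_pow_tendsto 1).comp (tendsto_mul_left_nhdsGT_zero hl)).mul_const
    (l * besselK 1 l / 2))
  simp only [Nat.factorial_one, Nat.cast_one, div_one, one_mul, pow_one] at h
  refine h.congr' ?_
  filter_upwards [self_mem_nhdsWithin] with b hb
  have hb : 0 < b := hb
  simp only [Function.comp_apply, Lam]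
  field_simp

theorem Lam_tendsto_zero (n : ℕ) {l : ℝ} (hl : 0 < l) :
    Tendsto (fun b : ℝ => Lam (n + 1) l b) (nhdsWithin 0 (Set.Ioi 0)) (nhds 0) := by
  have hc : Continuous fun b : ℝ => (l * b / 2) ^ (n + 1) * besselK (n + 1) l := by fun_prop
  have hp := (hc.tendsto 0).mono_left (nhdsWithin_le_nhds (s := Set.Ioi 0))
  have h := ((besselI_div_pow_tendsto (n + 1)).comp (tendsto_mul_left_nhdsGT_zero hl)).mul hp
  simp only [mul_zero, zero_div, ne_eq, Nat.succ_ne_zero, not_false_eq_true, zero_pow,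
    zero_mul] at h
  refine h.congr' ?_
  filter_upwards [self_mem_nhdsWithin] with b hb
  have hb : 0 < b := hb
  simp only [Function.comp_apply, Lam]
  field_simp

theorem Bfun_div_tendsto (n : ℕ) {l : ℝ} (hl : 0 < l) :
    Tendsto (fun b : ℝ => Bfun (n + 1) l b / b) (nhdsWithin 0 (Set.Ioi 0))
      (nhds (l * besselK 1 l / 2 + (Om (n + 1) l - (1 / 2 - 1 / (2 * (n + 1 : ℕ)))))) := by
  have hb0 : Tendsto (fun b : ℝ => b) (nhdsWithin 0 (Set.Ioi 0)) (nhds 0) :=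
    tendsto_id.mono_left nhdsWithin_le_nhds
  have h := (((hb0.pow 2).const_sub 1).mul (Lam_div_tendsto hl)).add
    ((Om_tendsto n hl).const_sub (Om (n + 1) l))
  norm_num only [sub_zero, one_mul] at h
  refine (h.congr' ?_).trans (le_of_eq ?_)
  · filter_upwards [self_mem_nhdsWithin] with b hb
    have hb : 0 < b := hb
    simp only [Bfun]
    field_simp
  · norm_num

theorem sqrt_Del_div_tendsto (n : ℕ) {l : ℝ} (hl : 0 < l) :
    Tendsto (fun b : ℝ => Real.sqrt (Del (n + 1) l b) / b) (nhdsWithin 0 (Set.Ioi 0))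
      (nhds |Om (n + 1) l + (1 / 2 - 1 / (2 * (n + 1 : ℕ))) - l * besselK 1 l / 2|) := by
  have hb0 : Tendsto (fun b : ℝ => b) (nhdsWithin 0 (Set.Ioi 0)) (nhds 0) :=
    tendsto_id.mono_left nhdsWithin_le_nhds
  have h := (((((Om_tendsto n hl).const_add (Om (n + 1) l)).sub
    (((hb0.pow 2).const_add 1).mul (Lam_div_tendsto hl))).pow 2).sub
    (((Lam_tendsto_zero n hl).pow 2).const_mul 4)).sqrt
  have hlim : (Om (n + 1) l + (1 / 2 - 1 / (2 * (n + 1 : ℕ))) -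
      (1 + 0 ^ 2) * (l * besselK 1 l / 2)) ^ 2 - 4 * (0 : ℝ) ^ 2 =
      (Om (n + 1) l + (1 / 2 - 1 / (2 * (n + 1 : ℕ))) - l * besselK 1 l / 2) ^ 2 := by ring
  rw [hlim, Real.sqrt_sq_eq_abs] at h
  refine h.congr' ?_
  filter_upwards [self_mem_nhdsWithin] with b hb
  have hb : 0 < b := hb
  rw [eq_div_iff hb.ne', ← Real.sqrt_sq hb.le, ← Real.sqrt_mul' _ (sq_nonneg b),
    Real.sqrt_sq hb.le]
  congr 1
  simp only [Del]
  field_simp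

theorem eventually_limit_root_nonneg {l : ℝ} (hl : 0 < l) :
    ∀ᶠ n : ℕ in atTop,
      0 ≤ Om (n + 1) l + (1 / 2 - 1 / (2 * (n + 1 : ℕ))) - l * besselK 1 l / 2 := by
  have hI : 0 < besselI 1 l := lt_of_lt_of_le (by positivity) (le_besselI_s16 1 hl.le)
  have hIK : 0 < besselI 1 l * besselK 1 l := mul_pos hI (besselK_pos 0 hl)
  have hK : besselK 1 l * (l / 2) ≤ 1 / 2 := by simpa using besselK_mul_pow_le 0 hl
  have hlim := (tendsto_one_div_add_atTop_nhds_zero_nat (𝕜 := ℝ)).const_mul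
    (Real.exp ((l / 2) ^ 2) / 2 + 1 / 2)
  rw [mul_zero] at hlim
  filter_upwards [hlim.eventually_lt_const hIK] with n hn
  have hle := besselI_mul_besselK_le_s16 n hl
  have he : 1 / (2 * ((n + 1 : ℕ) : ℝ)) = 1 / 2 * (1 / ((n : ℝ) + 1)) := by
    push_cast
    field_simp
  rw [he, Om]
  linarith

/-- convergence of the spectrum as `b → 0⁺`: for `n ≥ Ñ(λ)` one has
`Ω_n^+(λ,b) → Ω_n(λ)` and `Ω_n^−(λ,b) → (λnK_1(λ) − n + 1)/(2n)`. -/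
theorem spectrum_continuity_simply_connected (l : ℝ) (hl : 0 < l) :
    ∃ N : ℕ, ∀ n : ℕ, N ≤ n →
      Tendsto (fun b : ℝ => OmP n l b) (nhdsWithin 0 (Set.Ioi 0)) (nhds (Om n l)) ∧
      Tendsto (fun b : ℝ => OmM n l b) (nhdsWithin 0 (Set.Ioi 0))
        (nhds ((l * n * besselK 1 l - n + 1) / (2 * n))) := by
  obtain ⟨N, hN⟩ := eventually_atTop.1 (eventually_limit_root_nonneg hl)
  refine ⟨N + 1, fun n hn => ?_⟩
  obtain ⟨m, rfl⟩ : ∃ m, n = m + 1 := ⟨n - 1, by omega⟩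
  have hB := Bfun_div_tendsto m hl
  have hD := sqrt_Del_div_tendsto m hl
  rw [abs_of_nonneg (hN m (by omega))] at hD
  constructor
  · have h := (hB.add hD).div_const 2
    refine (h.congr fun b => ?_).trans (le_of_eq ?_)
    · rw [OmP, ← add_div, div_div, mul_comm b]
    · congr 1
      ring
  · have h := (hB.sub hD).div_const 2
    refine (h.congr fun b => ?_).trans (le_of_eq ?_)
    · rw [OmM, ← sub_div, div_div, mul_comm b]
    · congr 1
      field_simp
      ring
end
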